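/- The space Syz̄_3 of linear syzygies of the generalized 2×2 permanents (families (c_w) of linear forms with Σ_w c_w p_w = 0) has dimension (m(m²−1)/3)·binom(n+2,3) + binom(m+2,3)·(n(n²−1)/3). -/

import Mathlib

open MvPolynomial

/-- Index set for the generalized 2×2 permanents of a generic `m × n` matrix:
quadruples `((i,i'),(j,j'))` with `i ≤ i'` and `j ≤ j'`. -/
def PermIdx (m n : ℕ) : Type :=
  {w : (Fin m × Fin m) × (Fin n × Fin n) // w.1.1 ≤ w.1.2 ∧ w.2.1 ≤ w.2.2}

instance (m n : ℕ) : Fintype (PermIdx m n) := by unfold PermIdx; infer_instance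

instance (m n : ℕ) : DecidableEq (PermIdx m n) := by unfold PermIdx; infer_instance

/-- The generalized 2×2 permanent
`p_{(i,i'),(j,j')} = x_{i,j} x_{i',j'} + x_{i,j'} x_{i',j}`. -/
noncomputable def perm {m n : ℕ} (w : PermIdx m n) : MvPolynomial (Fin m × Fin n) ℂ :=
  X (w.1.1.1, w.1.2.1) * X (w.1.1.2, w.1.2.2) + X (w.1.1.1, w.1.2.2) * X (w.1.1.2, w.1.2.1)

/-- `Syz̄_d`: the ℂ-vector space of degree-`d` syzygies of the generalized 2×2
permanents, i.e. families `c = (c_w)` of homogeneous polynomials of degree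
`d - 2` with `∑_w c_w p_w = 0`. -/
noncomputable def SyzBar (m n d : ℕ) :
    Submodule ℂ (PermIdx m n → MvPolynomial (Fin m × Fin n) ℂ) where
  carrier := {c | (∀ w, c w ∈ homogeneousSubmodule (Fin m × Fin n) ℂ (d - 2)) ∧
    ∑ w, c w * perm w = 0}
  zero_mem' := by
    refine ⟨fun w => Submodule.zero_mem _, ?_⟩
    simp
  add_mem' := by
    rintro a b ⟨ha1, ha2⟩ ⟨hb1, hb2⟩
    refine ⟨fun w => Submodule.add_mem _ (ha1 w) (hb1 w), ?_⟩
    simp only [Pi.add_apply, add_mul]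
    rw [Finset.sum_add_distrib, ha2, hb2, add_zero]
  smul_mem' := by
    rintro r a ⟨ha1, ha2⟩
    refine ⟨fun w => Submodule.smul_mem _ r (ha1 w), ?_⟩
    simp only [Pi.smul_apply, smul_mul_assoc]
    rw [← Finset.smul_sum, ha2, smul_zero]

/-- The `S`-submodule of the free module `F = ⊕_w S·e_w` generated by the
Koszul syzygies `p_{w'}·e_w − p_w·e_{w'}`. -/
noncomputable def KosModBar (m n : ℕ) :
    Submodule (MvPolynomial (Fin m × Fin n) ℂ)
      (PermIdx m n → MvPolynomial (Fin m × Fin n) ℂ) :=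
  Submodule.span _ {k | ∃ w w' : PermIdx m n,
    k = Pi.single w (perm w') - Pi.single w' (perm w)}

/-- `Kos̄_d`: the space of degree-`d` syzygies lying in the `S`-submodule
generated by the Koszul syzygies. -/
noncomputable def KosBar (m n d : ℕ) :
    Submodule ℂ (PermIdx m n → MvPolynomial (Fin m × Fin n) ℂ) :=
  SyzBar m n d ⊓ Submodule.restrictScalars ℂ (KosModBar m n)


namespace PermSyz

variable {m n : ℕ}

/-- Exponent vector of the cubic monomial with row indices `u`, column indices `v`. -/
noncomputable def expo (u : Fin 3 → Fin m) (v : Fin 3 → Fin n) : (Fin m × Fin n) →₀ ℕ :=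
  ∑ k, Finsupp.single (u k, v k) 1

/-- The cubic monomial with row indices `u`, column indices `v`. -/
noncomputable def mon (u : Fin 3 → Fin m) (v : Fin 3 → Fin n) : MvPolynomial (Fin m × Fin n) ℂ :=
  monomial (expo u v) 1

lemma mon_eq (u : Fin 3 → Fin m) (v : Fin 3 → Fin n) :
    mon u v = ∏ k, (X (u k, v k) : MvPolynomial (Fin m × Fin n) ℂ) := by
  unfold mon expo
  rw [Fin.sum_univ_three, Fin.prod_univ_three]
  simp [X, monomial_mul]

lemma expo_comp (u : Fin 3 → Fin m) (v : Fin 3 → Fin n) (τ : Equiv.Perm (Fin 3)) :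
    expo (u ∘ τ) (v ∘ τ) = expo u v := by
  unfold expo
  exact Equiv.sum_comp τ (fun k => Finsupp.single (u k, v k) 1)

lemma mem_support_expo (u : Fin 3 → Fin m) (v : Fin 3 → Fin n) (a : Fin m × Fin n) :
    expo u v a ≠ 0 ↔ ∃ k, (u k, v k) = a := by
  unfold expo
  rw [Finsupp.finsetSum_apply, Ne, Finset.sum_eq_zero_iff]
  simp [Finsupp.single_apply]

lemma expo_eq_iff (u I : Fin 3 → Fin m) (v J : Fin 3 → Fin n) (hI : Function.Injective I) :
    expo u v = expo I J ↔ ∃ τ : Equiv.Perm (Fin 3), u = I ∘ τ ∧ v = J ∘ τ := by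
  constructor
  · intro h
    have h1 : ∀ k, ∃ l, (I l, J l) = (u k, v k) := fun k => by
      rw [← mem_support_expo, ← h, mem_support_expo]; exact ⟨k, rfl⟩
    have h2 : ∀ l, ∃ k, (u k, v k) = (I l, J l) := fun k => by
      rw [← mem_support_expo, h, mem_support_expo]; exact ⟨k, rfl⟩
    choose t ht using h1
    have hs : Function.Surjective t := fun l => by
      obtain ⟨k, hk⟩ := h2 l
      refine ⟨k, hI ?_⟩
      have := (ht k).trans hk
      exact (Prod.ext_iff.1 this).1
    refine ⟨Equiv.ofBijective t (Finite.injective_iff_bijective.1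
      (Finite.injective_iff_surjective.2 hs)), ?_, ?_⟩
    · funext k; exact (Prod.ext_iff.1 (ht k)).1.symm
    · funext k; exact (Prod.ext_iff.1 (ht k)).2.symm
  · rintro ⟨τ, rfl, rfl⟩
    exact expo_comp _ _ _

/-- Alternating functional. -/
noncomputable def alt (I : Fin 3 → Fin m) (J : Fin 3 → Fin n) :
    MvPolynomial (Fin m × Fin n) ℂ →ₗ[ℂ] ℂ :=
  ∑ σ : Equiv.Perm (Fin 3), ((Equiv.Perm.sign σ : ℤ) : ℂ) • lcoeff ℂ (expo I (J ∘ σ))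

open Classical in
lemma alt_mon (I u : Fin 3 → Fin m) (J v : Fin 3 → Fin n) :
    alt I J (mon u v) = ∑ σ : Equiv.Perm (Fin 3), ((Equiv.Perm.sign σ : ℤ) : ℂ) *
      if expo u v = expo I (J ∘ σ) then 1 else 0 := by
  unfold alt mon
  simp [LinearMap.sum_apply, lcoeff, coeff_monomial]

lemma alt_swap (I u : Fin 3 → Fin m) (J v : Fin 3 → Fin n) (hI : Function.Injective I)
    (s : Equiv.Perm (Fin 3)) (hs : Equiv.Perm.sign s = -1) :
    alt I J (mon u (v ∘ s)) = - alt I J (mon u v) := by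
  classical
  rw [alt_mon, alt_mon]
  by_cases hu : ∃ τ : Equiv.Perm (Fin 3), u = I ∘ τ
  · obtain ⟨τ, rfl⟩ := hu
    have key : ∀ (w : Fin 3 → Fin n) (σ : Equiv.Perm (Fin 3)),
        expo (I ∘ τ) w = expo I (J ∘ σ) ↔ w = J ∘ (σ * τ : Equiv.Perm (Fin 3)) := by
      intro w σ
      rw [expo_eq_iff _ _ _ _ hI]
      constructor
      · rintro ⟨τ', h1, rfl⟩
        have : τ = τ' := by
          ext k; exact congrArg _ (hI (congrFun h1 k))
        subst this; rfl
      · rintro rfl; exact ⟨τ, rfl, rfl⟩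
    simp only [key]
    rw [← Finset.sum_neg_distrib,
      ← Equiv.sum_comp (Equiv.mulRight (τ * s * τ⁻¹))]
    refine Finset.sum_congr rfl fun σ _ => ?_
    have e : (v ∘ s = J ∘ ((σ * (τ * s * τ⁻¹)) * τ : Equiv.Perm (Fin 3))) ↔
        v = J ∘ (σ * τ : Equiv.Perm (Fin 3)) := by
      have : (σ * (τ * s * τ⁻¹)) * τ = (σ * τ) * s := by group
      rw [this, Equiv.Perm.coe_mul (σ * τ) s, ← Function.comp_assoc]
      exact s.surjective.injective_comp_right.eq_iff
    simp only [Equiv.coe_mulRight, e]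
    simp [hs]
  · have : ∀ (w : Fin 3 → Fin n) (σ : Equiv.Perm (Fin 3)), ¬ expo u w = expo I (J ∘ σ) := by
      intro w σ h
      rw [expo_eq_iff _ _ _ _ hI] at h
      obtain ⟨τ, h, -⟩ := h
      exact hu ⟨τ, h⟩
    simp [this]

/-- Unrestricted permanent. -/
noncomputable def pp (i i' : Fin m) (j j' : Fin n) : MvPolynomial (Fin m × Fin n) ℂ :=
  X (i, j) * X (i', j') + X (i, j') * X (i', j)

lemma X_mul_pp (a : Fin m × Fin n) (i i' : Fin m) (j j' : Fin n) :
    X a * pp i i' j j' = mon ![a.1, i, i'] ![a.2, j, j'] +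
      mon ![a.1, i, i'] (![a.2, j, j'] ∘ Equiv.swap 1 2) := by
  rw [mon_eq, mon_eq, Fin.prod_univ_three, Fin.prod_univ_three]
  have h0 : (Equiv.swap (1 : Fin 3) 2) 0 = 0 := by decide
  simp [pp, h0]
  ring

lemma alt_perm (I : Fin 3 → Fin m) (J : Fin 3 → Fin n) (hI : Function.Injective I)
    (a : Fin m × Fin n) (w : PermIdx m n) : alt I J (X a * perm w) = 0 := by
  have : perm w = pp w.1.1.1 w.1.1.2 w.1.2.1 w.1.2.2 := rfl
  rw [this, X_mul_pp, map_add, alt_swap _ _ _ _ hI _ (Equiv.Perm.sign_swap (by decide)), add_neg_cancel]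

/-- The coefficient families, as families of linear forms. -/
noncomputable def G (m n : ℕ) : (PermIdx m n → Fin m × Fin n → ℂ) →ₗ[ℂ]
    (PermIdx m n → MvPolynomial (Fin m × Fin n) ℂ) :=
  LinearMap.pi fun w => ∑ a, (LinearMap.toSpanSingleton ℂ (MvPolynomial (Fin m × Fin n) ℂ) (X a)) ∘ₗ
    LinearMap.proj a ∘ₗ LinearMap.proj w

lemma G_apply (c : PermIdx m n → Fin m × Fin n → ℂ) (w : PermIdx m n) :
    G m n c w = ∑ a, c w a • X a := by
  simp [G]

lemma G_inj : Function.Injective (G m n) := by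
  intro c c' h
  funext w a
  have := congrArg (coeff (Finsupp.single a 1)) (congrFun h w)
  simpa [G_apply, coeff_sum, coeff_X, Finsupp.single_left_inj] using this

/-- Sum against the permanents. -/
noncomputable def S (m n : ℕ) : (PermIdx m n → MvPolynomial (Fin m × Fin n) ℂ) →ₗ[ℂ]
    MvPolynomial (Fin m × Fin n) ℂ :=
  ∑ w, (LinearMap.mulRight ℂ (perm w)) ∘ₗ LinearMap.proj w

lemma S_apply (c : PermIdx m n → MvPolynomial (Fin m × Fin n) ℂ) :
    S m n c = ∑ w, c w * perm w := by
  simp [S]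

/-- The multiplication map. -/
noncomputable def L (m n : ℕ) : (PermIdx m n → Fin m × Fin n → ℂ) →ₗ[ℂ]
    MvPolynomial (Fin m × Fin n) ℂ := S m n ∘ₗ G m n

lemma L_apply (c : PermIdx m n → Fin m × Fin n → ℂ) :
    L m n c = ∑ w, ∑ a, c w a • (X a * perm w) := by
  simp [L, S_apply, G_apply, Finset.sum_mul]

lemma syz_eq : SyzBar m n 3 = (LinearMap.ker (L m n)).map (G m n) := by
  ext c
  constructor
  · rintro ⟨h1, h2⟩
    have : ∀ w, ∃ f : Fin m × Fin n → ℂ, ∑ a, f a • X a = c w := by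
      intro w
      have h := h1 w
      rw [show 3 - 2 = 1 from rfl, homogeneousSubmodule_one_eq_span_X] at h
      exact (Submodule.mem_span_range_iff_exists_fun ℂ).1 h
    choose f hf using this
    have hG : G m n f = c := by funext w; rw [G_apply, hf]
    refine ⟨f, ?_, hG⟩
    rw [SetLike.mem_coe, LinearMap.mem_ker, L, LinearMap.comp_apply, hG, S_apply, h2]
  · rintro ⟨f, hf, rfl⟩
    refine ⟨fun w => ?_, ?_⟩
    · rw [show 3 - 2 = 1 from rfl, homogeneousSubmodule_one_eq_span_X, G_apply]
      exact (Submodule.mem_span_range_iff_exists_fun ℂ).2 ⟨_, rfl⟩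
    · rw [← S_apply]; exact hf

lemma finrank_syz : Module.finrank ℂ (SyzBar m n 3) +
    Module.finrank ℂ (LinearMap.range (L m n)) = Fintype.card (PermIdx m n) * (m * n) := by
  rw [syz_eq, ← (Submodule.equivMapOfInjective (G m n) G_inj (LinearMap.ker (L m n))).finrank_eq,
    add_comm, LinearMap.finrank_range_add_finrank_ker]
  simp [Module.finrank_pi_fintype]

lemma basic_mem (a : Fin m × Fin n) (w : PermIdx m n) :
    X a * perm w ∈ LinearMap.range (L m n) := by
  refine ⟨Pi.single w (Pi.single a 1), ?_⟩
  rw [L_apply, Finset.sum_eq_single w, Finset.sum_eq_single a]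
  · simp
  · intro b _ hb; simp [hb]
  · simp
  · intro b _ hb; simp [hb]
  · simp

lemma pp_mem (a : Fin m × Fin n) (i i' : Fin m) (j j' : Fin n) :
    X a * pp i i' j j' ∈ LinearMap.range (L m n) := by
  rcases le_total i i' with hi | hi <;> rcases le_total j j' with hj | hj
  · exact basic_mem a ⟨((i, i'), (j, j')), hi, hj⟩
  · convert basic_mem a ⟨((i, i'), (j', j)), hi, hj⟩ using 2
    simp only [perm, pp]; ring
  · convert basic_mem a ⟨((i', i), (j, j')), hi, hj⟩ using 2
    simp only [perm, pp]; ring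
  · convert basic_mem a ⟨((i', i), (j', j)), hi, hj⟩ using 2
    simp only [perm, pp]; ring

lemma mon_comp (u : Fin 3 → Fin m) (v : Fin 3 → Fin n) (τ : Equiv.Perm (Fin 3)) :
    mon (u ∘ τ) (v ∘ τ) = mon u v := by
  unfold mon; rw [expo_comp]

lemma swap_mem (u : Fin 3 → Fin m) (v : Fin 3 → Fin n) (x y : Fin 3) (hxy : x ≠ y) :
    mon u v + mon u (v ∘ Equiv.swap x y) ∈ LinearMap.range (L m n) := by
  obtain ⟨z, hzx, hzy⟩ : ∃ z : Fin 3, z ≠ x ∧ z ≠ y := by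
    revert x y; decide
  have hu : (Finset.univ : Finset (Fin 3)) = {z, x, y} := by
    revert x y z; decide
  have hx : x ∉ ({y} : Finset (Fin 3)) := by simpa using hxy
  have hz : z ∉ ({x, y} : Finset (Fin 3)) := by simp [hzx, hzy]
  convert pp_mem (u z, v z) (u x) (u y) (v x) (v y) using 1
  rw [mon_eq, mon_eq, hu, Finset.prod_insert hz, Finset.prod_insert hx, Finset.prod_singleton,
    Finset.prod_insert hz, Finset.prod_insert hx, Finset.prod_singleton]
  simp [pp, Equiv.swap_apply_of_ne_of_ne hzx hzy]
  ring

lemma half_mem {p : MvPolynomial (Fin m × Fin n) ℂ} {R : Submodule ℂ (MvPolynomial (Fin m × Fin n) ℂ)}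
    (h : p + p ∈ R) : p ∈ R := by
  have := R.smul_mem (2⁻¹ : ℂ) h
  rwa [← two_smul ℂ p, smul_smul, inv_mul_cancel₀ two_ne_zero, one_smul] at this

lemma comp_swap_eq {α : Type*} (f : Fin 3 → α) {x y : Fin 3} (h : f x = f y) :
    f ∘ Equiv.swap x y = f := by
  funext k
  simp only [Function.comp_apply, Equiv.swap_apply_def]
  split_ifs with h1 h2
  · rw [h1, h]
  · rw [h2, h]
  · rfl

lemma mem_of_not_inj (u : Fin 3 → Fin m) (v : Fin 3 → Fin n)
    (h : ¬ (Function.Injective u ∧ Function.Injective v)) :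
    mon u v ∈ LinearMap.range (L m n) := by
  rw [not_and_or] at h
  apply half_mem
  rcases h with h | h
  · simp only [Function.Injective, not_forall] at h
    obtain ⟨x, y, hxy, hne⟩ := h
    have := swap_mem u v x y hne
    rwa [← mon_comp u (v ∘ _) (Equiv.swap x y), comp_swap_eq u hxy, Function.comp_assoc,
      ← Equiv.Perm.coe_mul, Equiv.swap_mul_self, Equiv.Perm.coe_one, Function.comp_id] at this
  · simp only [Function.Injective, not_forall] at h
    obtain ⟨x, y, hxy, hne⟩ := h
    have := swap_mem u v x y hne
    rwa [comp_swap_eq v hxy] at this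

/-- Index set of the diagonal monomials. -/
abbrev T (m n : ℕ) : Type := (Fin 3 ↪o Fin m) × (Fin 3 ↪o Fin n)

noncomputable instance (k : ℕ) : Fintype (Fin 3 ↪o Fin k) :=
  Fintype.ofEquiv _ (Set.powersetCard.ofFinEmbEquiv (n := 3) (I := Fin k)).symm

lemma card_T : Fintype.card (T m n) = m.choose 3 * n.choose 3 := by
  have h : ∀ k : ℕ, Fintype.card (Fin 3 ↪o Fin k) = k.choose 3 := fun k => by
    rw [← Nat.card_eq_fintype_card, Nat.card_congr (Set.powersetCard.ofFinEmbEquiv (n := 3) (I := Fin k)),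
      Set.powersetCard.card, Nat.card_eq_fintype_card, Fintype.card_fin]
  rw [Fintype.card_prod, h, h]

/-- Span map of the diagonal monomials. -/
noncomputable def Δ (m n : ℕ) : (T m n → ℂ) →ₗ[ℂ] MvPolynomial (Fin m × Fin n) ℂ :=
  Fintype.linearCombination ℂ fun t : T m n => mon t.1 t.2

lemma diag_mem (t : T m n) : mon t.1 t.2 ∈ LinearMap.range (Δ m n) := by
  classical
  refine ⟨Pi.single t 1, ?_⟩
  simp [Δ, Fintype.linearCombination_apply_single]

lemma strictMono_eq {k : ℕ} (I I' : Fin 3 ↪o Fin k) (τ : Equiv.Perm (Fin 3))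
    (h : (I : Fin 3 → Fin k) = I' ∘ τ) : I = I' ∧ τ = 1 := by
  have hr : Set.range I = Set.range I' := by
    rw [h, Set.range_comp, τ.surjective.range_eq, Set.image_univ]
  have : I = I' := by
    apply Set.powersetCard.ofFinEmbEquiv.injective
    apply SetLike.coe_injective
    ext x
    simp only [SetLike.mem_coe, Set.powersetCard.mem_ofFinEmbEquiv_iff_mem_range, hr]
  subst this
  refine ⟨rfl, ?_⟩
  ext x
  exact congrArg _ (I.injective (congrFun h x)).symm

open Classical in
lemma alt_diag (t t' : T m n) : alt t.1 t.2 (mon t'.1 t'.2) = if t = t' then 1 else 0 := by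
  rw [alt_mon]
  have key : ∀ σ : Equiv.Perm (Fin 3), expo t'.1 t'.2 = expo t.1 (t.2 ∘ σ) ↔ t = t' ∧ σ = 1 := by
    intro σ
    rw [expo_eq_iff _ _ _ _ t.1.injective]
    constructor
    · rintro ⟨τ, h1, h2⟩
      obtain ⟨e1, rfl⟩ := strictMono_eq _ _ _ h1
      obtain ⟨e2, h⟩ := strictMono_eq t'.2 t.2 (σ * 1) h2
      exact ⟨Prod.ext e1.symm e2.symm, by simpa using h⟩
    · rintro ⟨rfl, rfl⟩
      exact ⟨1, rfl, rfl⟩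
  simp only [key]
  by_cases h : t = t' <;> simp [h]

lemma alt_Δ (f : T m n → ℂ) (t : T m n) : alt t.1 t.2 (Δ m n f) = f t := by
  classical
  simp [Δ, Fintype.linearCombination_apply, alt_diag]

lemma alt_L (c) (t : T m n) : alt t.1 t.2 (L m n c) = 0 := by
  rw [L_apply]
  simp [alt_perm _ _ t.1.injective]

lemma disj : LinearMap.range (L m n) ⊓ LinearMap.range (Δ m n) = ⊥ := by
  rw [eq_bot_iff]
  rintro _ ⟨⟨c, hc⟩, ⟨f, rfl⟩⟩
  have : f = 0 := by
    funext t
    rw [← alt_Δ f t, ← hc, alt_L]; rfl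
  simp [this]

lemma Δ_inj : Function.Injective (Δ m n) := by
  intro f g h
  funext t
  rw [← alt_Δ f t, h, alt_Δ]

lemma perm_mem (u : Fin 3 → Fin m) (σ : Equiv.Perm (Fin 3)) : ∀ (v : Fin 3 → Fin n)
    (R : Submodule ℂ (MvPolynomial (Fin m × Fin n) ℂ)) (_ : LinearMap.range (L m n) ≤ R)
    (_ : mon u (v ∘ σ) ∈ R), mon u v ∈ R := by
  induction σ using Equiv.Perm.swap_induction_on with
  | one => intro v R _ h; exact h
  | swap_mul f x y hxy ih =>
    intro v R hR h
    have h1 := ih (v ∘ Equiv.swap x y) R hR h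
    have h2 := R.sub_mem (hR (swap_mem u v x y hxy)) h1
    simpa using h2

lemma exists_sort {k : ℕ} (u : Fin 3 → Fin k) (hu : Function.Injective u) :
    ∃ (τ : Equiv.Perm (Fin 3)) (I : Fin 3 ↪o Fin k), u ∘ τ = I := by
  have h : StrictMono (u ∘ Tuple.sort u) :=
    (Tuple.monotone_sort u).strictMono_of_injective (hu.comp (Tuple.sort u).injective)
  exact ⟨Tuple.sort u, OrderEmbedding.ofStrictMono _ h, rfl⟩

lemma mon_mem (u : Fin 3 → Fin m) (v : Fin 3 → Fin n) :
    mon u v ∈ LinearMap.range (L m n) ⊔ LinearMap.range (Δ m n) := by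
  by_cases h : Function.Injective u ∧ Function.Injective v
  · obtain ⟨τ, I, hI⟩ := exists_sort u h.1
    obtain ⟨τ', J, hJ⟩ := exists_sort (v ∘ τ) (h.2.comp τ.injective)
    rw [← mon_comp u v τ]
    apply perm_mem _ τ' _ _ le_sup_left
    rw [hI, hJ]
    exact le_sup_right (a := LinearMap.range (L m n)) (diag_mem (I, J))
  · exact le_sup_left (b := LinearMap.range (Δ m n)) (mem_of_not_inj u v h)

lemma degree_expo (u : Fin 3 → Fin m) (v : Fin 3 → Fin n) : (expo u v).degree = 3 := by
  simp [expo, map_sum, Finsupp.degree_single]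

lemma exists_expo (d : (Fin m × Fin n) →₀ ℕ) (hd : d.degree = 3) : ∃ u v, d = expo u v := by
  have hc : Multiset.card (Finsupp.toMultiset d) = 3 := by
    rw [Finsupp.card_toMultiset]; exact hd
  obtain ⟨x, y, z, h⟩ := Multiset.card_eq_three.1 hc
  refine ⟨![x.1, y.1, z.1], ![x.2, y.2, z.2], ?_⟩
  apply (Multiset.toFinsupp (α := Fin m × Fin n)).symm.injective
  change Finsupp.toMultiset d = Finsupp.toMultiset _
  rw [h]
  simp [expo, Fin.sum_univ_three, Finsupp.toMultiset_single]

lemma mon_hom (u : Fin 3 → Fin m) (v : Fin 3 → Fin n) :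
    mon u v ∈ homogeneousSubmodule (Fin m × Fin n) ℂ 3 :=
  isHomogeneous_monomial _ (degree_expo u v)

lemma sup_eq : LinearMap.range (L m n) ⊔ LinearMap.range (Δ m n) =
    homogeneousSubmodule (Fin m × Fin n) ℂ 3 := by
  apply le_antisymm
  · apply sup_le
    · rintro _ ⟨c, rfl⟩
      rw [L_apply]
      refine Submodule.sum_mem _ fun w _ => Submodule.sum_mem _ fun a _ => Submodule.smul_mem _ _ ?_
      have : perm w = pp w.1.1.1 w.1.1.2 w.1.2.1 w.1.2.2 := rfl
      rw [this, X_mul_pp]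
      exact Submodule.add_mem _ (mon_hom _ _) (mon_hom _ _)
    · rintro _ ⟨f, rfl⟩
      rw [Δ, Fintype.linearCombination_apply]
      exact Submodule.sum_mem _ fun t _ => Submodule.smul_mem _ _ (mon_hom _ _)
  · intro p hp
    rw [p.as_sum]
    refine Submodule.sum_mem _ fun d hd => ?_
    have hd3 : d.degree = 3 := by
      have := hp (mem_support_iff.1 hd)
      rw [Finsupp.degree_eq_weight_one]; exact this
    obtain ⟨u, v, rfl⟩ := exists_expo d hd3
    have := Submodule.smul_mem _ (coeff (expo u v) p) (mon_mem u v)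
    rwa [mon, smul_monomial, smul_eq_mul, mul_one] at this

lemma finrank_hom : Module.finrank ℂ (homogeneousSubmodule (Fin m × Fin n) ℂ 3) =
    (m * n + 2).choose 3 := by
  rw [homogeneousSubmodule_eq_finsupp_supported]
  have b := basisRestrictSupport (σ := Fin m × Fin n) ℂ {d | d.degree = 3}
  have h1 := Module.finrank_eq_nat_card_basis b
  have h2 := Nat.card_congr (Sym.equivNatSum (Fin m × Fin n) 3)
  rw [Nat.card_eq_fintype_card, Sym.card_sym_eq_choose, Fintype.card_prod, Fintype.card_fin,
    Fintype.card_fin] at h2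
  exact h1.trans h2.symm

lemma finrank_range : Module.finrank ℂ (LinearMap.range (L m n)) + m.choose 3 * n.choose 3 =
    (m * n + 2).choose 3 := by
  have h := Submodule.finrank_sup_add_finrank_inf_eq (LinearMap.range (L m n))
    (LinearMap.range (Δ m n))
  rw [disj, finrank_bot, sup_eq, finrank_hom, LinearMap.finrank_range_of_inj Δ_inj,
    Module.finrank_fintype_fun_eq_card, card_T] at h
  omega

lemma card_permIdx : Fintype.card (PermIdx m n) = (m + 1).choose 2 * (n + 1).choose 2 := by
  have e : PermIdx m n ≃ {p : Fin m × Fin m // p.1 ≤ p.2} × {p : Fin n × Fin n // p.1 ≤ p.2} :=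
    { toFun := fun w => (⟨w.1.1, w.2.1⟩, ⟨w.1.2, w.2.2⟩)
      invFun := fun q => ⟨(q.1.1, q.2.1), q.1.2, q.2.2⟩
      left_inv := fun _ => rfl
      right_inv := fun _ => rfl }
  rw [Fintype.card_congr (e.trans (Equiv.prodCongr Sym2.sortEquiv.symm Sym2.sortEquiv.symm)),
    Fintype.card_prod, Sym2.card, Sym2.card, Fintype.card_fin, Fintype.card_fin]

lemma choose_two (k : ℕ) : 2 * (k + 1).choose 2 = (k + 1) * k := by
  have := Nat.add_one_mul_choose_eq k 1
  rw [Nat.choose_one_right] at this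
  linarith

lemma choose_three (k : ℕ) : 6 * (k + 2).choose 3 = (k + 2) * (k + 1) * k := by
  have := Nat.add_one_mul_choose_eq (k + 1) 2
  have h2 := choose_two k
  have e : k + 1 + 1 = k + 2 := rfl
  simp only [e] at this
  nlinarith

lemma choose_three' (k : ℕ) : 6 * (((k + 1).choose 3 : ℕ) : ℤ) = (k + 1) * k * (k - 1) := by
  rcases k with _ | k
  · simp [Nat.choose_eq_zero_of_lt]
  · have := choose_three k
    zify at this
    push_cast
    have e : k + 1 + 1 = k + 2 := rfl
    rw [e, this]; ring

lemma s21 (k : ℕ) : 3 * ((((k + 1) * ((k + 1) ^ 2 - 1) / 3 : ℕ)) : ℤ) = (k + 1) * k * (k + 2) := by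
  have h : (k + 1) * ((k + 1) ^ 2 - 1) = 3 * (2 * (k + 2).choose 3) := by
    have h1 : (k + 1) ^ 2 - 1 = k * (k + 2) := by
      have : (k + 1) ^ 2 = k * (k + 2) + 1 := by ring
      omega
    have := choose_three k
    rw [h1]; linarith
  rw [h, Nat.mul_div_cancel_left _ (by norm_num)]
  have := choose_three k
  zify at this
  push_cast
  linarith

end PermSyz

/-- The space of linear syzygies of the generalized 2×2 permanents has dimension
`(m(m²−1)/3)·C(n+2,3) + C(m+2,3)·(n(n²−1)/3)`. -/
theorem dim_linear_syzygies_permanents (m n : ℕ) (hm : 1 ≤ m) (hn : 1 ≤ n) :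
    Module.finrank ℂ (SyzBar m n 3) =
      m * (m ^ 2 - 1) / 3 * Nat.choose (n + 2) 3 +
        Nat.choose (m + 2) 3 * (n * (n ^ 2 - 1) / 3) := by
  have h1 := PermSyz.finrank_syz (m := m) (n := n)
  have h2 := PermSyz.finrank_range (m := m) (n := n)
  rw [PermSyz.card_permIdx] at h1
  obtain ⟨a, rfl⟩ : ∃ a, m = a + 1 := ⟨m - 1, by omega⟩
  obtain ⟨b, rfl⟩ : ∃ b, n = b + 1 := ⟨n - 1, by omega⟩
  have a1 := PermSyz.s21 a
  have b1 := PermSyz.s21 b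
  have a2 := PermSyz.choose_three (a + 1)
  have b2 := PermSyz.choose_three (b + 1)
  have a3 := PermSyz.choose_three' a
  have b3 := PermSyz.choose_three' b
  have a4 := PermSyz.choose_two (a + 1)
  have b4 := PermSyz.choose_two (b + 1)
  have c := PermSyz.choose_three ((a + 1) * (b + 1))
  generalize Module.finrank ℂ (SyzBar (a + 1) (b + 1) 3) = D at *
  generalize Module.finrank ℂ (LinearMap.range (PermSyz.L (a + 1) (b + 1))) = R at *
  generalize (a + 1) * ((a + 1) ^ 2 - 1) / 3 = sa at *
  generalize (b + 1) * ((b + 1) ^ 2 - 1) / 3 = sb at *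
  generalize (a + 1 + 2).choose 3 = ca at *
  generalize (b + 1 + 2).choose 3 = cb at *
  generalize (a + 1).choose 3 = ta at *
  generalize (b + 1).choose 3 = tb at *
  generalize (a + 1 + 1).choose 2 = qa at *
  generalize (b + 1 + 1).choose 2 = qb at *
  generalize ((a + 1) * (b + 1) + 2).choose 3 = z at *
  zify at *
  have e1 : (sa : ℚ) = (a + 1) * a * (a + 2) / 3 := by
    have : (3 * sa : ℚ) = (a + 1) * a * (a + 2) := by exact_mod_cast a1
    linarith
  have e2 : (sb : ℚ) = (b + 1) * b * (b + 2) / 3 := by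
    have : (3 * sb : ℚ) = (b + 1) * b * (b + 2) := by exact_mod_cast b1
    linarith
  have e3 : (ca : ℚ) = (a + 3) * (a + 2) * (a + 1) / 6 := by
    have : (6 * ca : ℚ) = (a + 1 + 2) * (a + 1 + 1) * (a + 1) := by exact_mod_cast a2
    linarith
  have e4 : (cb : ℚ) = (b + 3) * (b + 2) * (b + 1) / 6 := by
    have : (6 * cb : ℚ) = (b + 1 + 2) * (b + 1 + 1) * (b + 1) := by exact_mod_cast b2
    linarith
  have e5 : (ta : ℚ) = (a + 1) * a * (a - 1) / 6 := by
    have : (6 * ta : ℚ) = (a + 1) * a * (a - 1) := by exact_mod_cast a3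
    linarith
  have e6 : (tb : ℚ) = (b + 1) * b * (b - 1) / 6 := by
    have : (6 * tb : ℚ) = (b + 1) * b * (b - 1) := by exact_mod_cast b3
    linarith
  have e7 : (qa : ℚ) = (a + 2) * (a + 1) / 2 := by
    have : (2 * qa : ℚ) = (a + 1 + 1) * (a + 1) := by exact_mod_cast a4
    linarith
  have e8 : (qb : ℚ) = (b + 2) * (b + 1) / 2 := by
    have : (2 * qb : ℚ) = (b + 1 + 1) * (b + 1) := by exact_mod_cast b4
    linarith
  have e9 : (z : ℚ) = ((a + 1) * (b + 1) + 2) * ((a + 1) * (b + 1) + 1) * ((a + 1) * (b + 1)) / 6 := by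
    have : (6 * z : ℚ) = ((a + 1) * (b + 1) + 2) * ((a + 1) * (b + 1) + 1) * ((a + 1) * (b + 1)) := by
      exact_mod_cast c
    linarith
  have f1 : (D + R : ℚ) = qa * qb * ((a + 1) * (b + 1)) := by exact_mod_cast h1
  have f2 : (R + ta * tb : ℚ) = z := by exact_mod_cast h2
  have : (D : ℚ) = sa * cb + ca * sb := by
    have : (D : ℚ) = qa * qb * ((a + 1) * (b + 1)) - (z - ta * tb) := by linarith
    rw [this, e1, e2, e3, e4, e5, e6, e7, e8, e9]
    ring
  exact_mod_cast this
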